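/- arXiv:math/0410406 — 6 statements merged into one kernel-verified Lean document; each statement's English description precedes it below -/
import Mathlib

section
/- Let X be an infinite set of singular cardinality κ = ℵ_α with λ = max(|α|, ℵ₀) < κ. Then the interval [S, A'] of submonoids of the full transformation monoid O^(1) between the permutations S and the monoid A' has cardinality 2^(2^λ). -/
open Cardinal

universe u

/-- The submonoid of all permutations inside the full transformation monoid `Function.End X`. -/
def permSubmonoid (X : Type u) : Submonoid (Function.End X) where
  carrier := {f | Function.Bijective f}
  mul_mem' hf hg := hf.comp hg
  one_mem' := Function.bijective_id

/-- A submonoid `C ≠ O⁽¹⁾` is precomplete iff together with any function outside of it,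
it generates the full transformation monoid. -/
def Precomplete {X : Type u} (C : Submonoid (Function.End X)) : Prop :=
  C ≠ ⊤ ∧ ∀ f : Function.End X, f ∉ C →
    Submonoid.closure ((C : Set (Function.End X)) ∪ {f}) = ⊤

/-- `f` is `ξ`-injective: `f` is injective off a set of cardinality `< ξ`. -/
def XiInjective {X : Type u} (ξ : Cardinal.{u}) (f : Function.End X) : Prop :=
  ∃ Y : Set X, #Y < ξ ∧ Set.InjOn f Yᶜ

/-- `f` is `ξ`-surjective: the complement of its range has cardinality `< ξ`. -/
def XiSurjective {X : Type u} (ξ : Cardinal.{u}) (f : Function.End X) : Prop :=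
  #((Set.range f)ᶜ : Set X) < ξ

/-- The set `A` of functions almost all of whose fibers are small. -/
def monA (X : Type u) : Set (Function.End X) :=
  {f | #{y : X | ¬ #(f ⁻¹' {y}) < #X} < #X}

/-- The set `A'` of functions `f` such that for some `ξ < |X|`, almost all fibers of `f`
have cardinality at most `ξ`. -/
def monA' (X : Type u) : Set (Function.End X) :=
  {f | ∃ ξ : Cardinal.{u}, ξ < #X ∧ #{x : X | ¬ #(f ⁻¹' {x}) ≤ ξ} < #X}

/-- The set `G_ξ` of functions which are `ξ`-injective or not `ξ`-surjective. -/
def monG (X : Type u) (ξ : Cardinal.{u}) : Set (Function.End X) :=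
  {f | XiInjective ξ f ∨ ¬ XiSurjective ξ f}

/-- The set `M_ξ` of functions which are `ξ`-surjective or not `ξ`-injective. -/
def monM (X : Type u) (ξ : Cardinal.{u}) : Set (Function.End X) :=
  {f | XiSurjective ξ f ∨ ¬ XiInjective ξ f}

/-- The kernel sequence of `f` assigns to every cardinal `ξ` the number of
(nonempty) fibers of `f` of cardinality `ξ`. -/
noncomputable def kernelSeq {X : Type u} (f : X → X) (ξ : Cardinal.{u}) : Cardinal.{u} :=
  #{A : Set X // (∃ y : X, A = f ⁻¹' {y}) ∧ A.Nonempty ∧ #A = ξ}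

/-- The set `R`: the range of the sequence `(n i)` together with all infinite
successor cardinals `≤ κ`. -/
def setR (κ : Cardinal.{u}) (n : ℕ → ℕ) : Set Cardinal.{u} :=
  (Set.range fun i : ℕ => (n i : Cardinal.{u})) ∪
    {ξ | ℵ₀ ≤ ξ ∧ ξ ≤ κ ∧ ∃ μ : Cardinal.{u}, ξ = Order.succ μ}

/-- The sum of a set of cardinals. -/
noncomputable def setSum (A : Set Cardinal.{u}) : Cardinal.{u + 1} :=
  Cardinal.sum fun η : A => (η : Cardinal.{u})

/-- On an infinite type there are `2 ^ #ι` subsets such that none is covered by finitely many of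
the others. -/
theorem exists_finitely_uncovered_family (ι : Type u) [Infinite ι] :
    ∃ A : Set ι → Set ι, ∀ (t : Set ι) (F : Set (Set ι)), F.Finite → t ∉ F →
      ¬ A t ⊆ ⋃ s ∈ F, A s := by
  classical
  have hcard : #(Finset ι × Finset (Finset ι)) = #ι := by
    simp [mul_eq_self (aleph0_le_mk ι)]
  obtain ⟨e⟩ := Cardinal.eq.1 hcard
  refine ⟨fun t => {i | (e.symm i).1.filter (· ∈ t) ∈ (e.symm i).2}, fun t F hF htF h => ?_⟩
  have hsep : ∀ s : Set ι, ∃ i, s ∈ F → ¬ (i ∈ s ↔ i ∈ t) := by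
    intro s
    by_cases hs : s ∈ F
    · have hne : s ≠ t := fun h => htF (h ▸ hs)
      obtain ⟨i, hi⟩ := not_forall.1 fun h => hne (Set.ext h)
      exact ⟨i, fun _ => hi⟩
    · exact ⟨Classical.arbitrary ι, fun h => absurd h hs⟩
  choose p hp using hsep
  let a : Finset ι := hF.toFinset.image p
  have ht : e (a, {a.filter (· ∈ t)}) ∈
      {i | (e.symm i).1.filter (· ∈ t) ∈ (e.symm i).2} := by simp
  obtain ⟨s, hsF, hs⟩ := Set.mem_iUnion₂.1 (h ht)
  simp only [Set.mem_ofPred_eq, Equiv.symm_apply_apply, Finset.mem_singleton] at hs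
  have hpa : p s ∈ a := Finset.mem_image_of_mem p (hF.mem_toFinset.2 hsF)
  have := Finset.ext_iff.1 hs (p s)
  simp only [Finset.mem_filter, hpa, true_and] at this
  exact hp s hsF this

/-- Two maps all of whose fibers have the same size differ by a permutation of the domain. -/
theorem exists_equiv_comp_eq_of_mk_fiber_eq {X : Type u} {Z : Type*} {p q : X → Z}
    (h : ∀ z, #{x // p x = z} = #{x // q x = z}) : ∃ e : X ≃ X, ∀ x, q (e x) = p x := by
  have h' : ∀ z, Nonempty ({x // p x = z} ≃ {x // q x = z}) := fun z => Cardinal.eq.1 (h z)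
  refine ⟨(Equiv.sigmaFiberEquiv p).symm.trans
    ((Equiv.sigmaCongrRight fun z => (h' z).some).trans (Equiv.sigmaFiberEquiv q)), fun x => ?_⟩
  exact ((h' (p x)).some ⟨x, rfl⟩).2

/-- A submonoid containing all permutations is determined by how many fibers of each size its
members have. -/
theorem mem_of_mk_fibers_eq {X : Type u} {M : Submonoid (Function.End X)}
    (hM : permSubmonoid X ≤ M) {f g : Function.End X}
    (h : ∀ ξ : Cardinal.{u}, #{y : X // #(f ⁻¹' {y}) = ξ} = #{y : X // #(g ⁻¹' {y}) = ξ})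
    (hf : f ∈ M) : g ∈ M := by
  obtain ⟨σ, hσ⟩ := exists_equiv_comp_eq_of_mk_fiber_eq
    (p := fun y => #(f ⁻¹' {y})) (q := fun y => #(g ⁻¹' {y})) h
  obtain ⟨τ, hτ⟩ := exists_equiv_comp_eq_of_mk_fiber_eq
    (p := g) (q := fun x => σ (f x)) (fun z => by
      have h1 := hσ (σ.symm z)
      rw [σ.apply_symm_apply] at h1
      refine h1.trans (mk_congr (Equiv.subtypeEquivRight fun x => ?_))
      exact σ.eq_symm_apply)
  let s : Function.End X := fun x => σ x
  let t : Function.End X := fun x => τ x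
  have hg : g = s * (f * t) := funext fun x => (hτ x).symm
  rw [hg]
  exact M.mul_mem (hM σ.bijective) (M.mul_mem hf (hM τ.bijective))

theorem mk_interval_le {X J : Type u} [Infinite J] (c : J → Cardinal.{u})
    (hc : ∀ ξ ≤ #X, ∃ j, c j = ξ) (P : Submonoid (Function.End X) → Prop) :
    #{M : Submonoid (Function.End X) // permSubmonoid X ≤ M ∧ P M} ≤
      (2 : Cardinal.{u}) ^ ((2 : Cardinal.{u}) ^ #J) := by
  have hI : ∀ (f : Function.End X) (j : J), ∃ k, c k = #{y : X // #(f ⁻¹' {y}) = c j} :=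
    fun f j => hc _ (mk_subtype_le _)
  choose I hI using hI
  have key : ∀ f g, I f = I g → ∀ ξ : Cardinal.{u},
      #{y : X // #(f ⁻¹' {y}) = ξ} = #{y : X // #(g ⁻¹' {y}) = ξ} := by
    intro f g hfg ξ
    by_cases hξ : ξ ≤ #X
    · obtain ⟨j, rfl⟩ := hc ξ hξ
      rw [← hI, ← hI, hfg]
    · have hempty : ∀ f : Function.End X, IsEmpty {y : X // #(f ⁻¹' {y}) = ξ} :=
        fun f => ⟨fun y => hξ (y.2 ▸ mk_set_le _)⟩
      have := hempty f
      have := hempty g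
      simp
  have hinj : Function.Injective
      fun M : {M : Submonoid (Function.End X) // permSubmonoid X ≤ M ∧ P M} =>
        I '' (M.1 : Set (Function.End X)) := by
    have hle : ∀ M N : {M : Submonoid (Function.End X) // permSubmonoid X ≤ M ∧ P M},
        I '' (M.1 : Set (Function.End X)) = I '' (N.1 : Set (Function.End X)) → M.1 ≤ N.1 := by
      intro M N h f hf
      obtain ⟨g, hg, hgf⟩ : I f ∈ I '' (N.1 : Set (Function.End X)) :=
        h ▸ Set.mem_image_of_mem I hf
      exact mem_of_mk_fibers_eq N.2.1 (key g f hgf) hg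
    exact fun M N h => Subtype.ext ((hle M N h).antisymm (hle N M h.symm))
  refine (mk_le_of_injective hinj).trans_eq ?_
  rw [mk_set, ← power_def, power_self_eq (aleph0_le_mk J)]

theorem mul_mem_monA' {X : Type u} [Infinite X] {f g : Function.End X} (hf : f ∈ monA' X)
    (hg : g ∈ monA' X) : f * g ∈ monA' X := by
  obtain ⟨ξ, hξ, hfξ⟩ := hf
  obtain ⟨ζ, hζ, hgζ⟩ := hg
  refine ⟨ξ * ζ, mul_lt_of_lt (aleph0_le_mk X) hξ hζ, ?_⟩
  have hsub : {x : X | ¬ #((f * g) ⁻¹' {x}) ≤ ξ * ζ} ⊆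
      {x : X | ¬ #(f ⁻¹' {x}) ≤ ξ} ∪ f '' {y : X | ¬ #(g ⁻¹' {y}) ≤ ζ} := by
    intro x hx
    by_contra hcon
    simp only [Set.mem_union, Set.mem_ofPred_eq, not_or, not_not] at hcon
    refine hx ?_
    have hU : (f * g) ⁻¹' {x} = ⋃ y ∈ f ⁻¹' {x}, g ⁻¹' {y} := by
      ext z
      simp only [Set.mem_iUnion, exists_prop]
      exact ⟨fun h => ⟨g z, h, rfl⟩, fun ⟨y, hy, hz⟩ => (congrArg f hz).trans hy⟩
    rw [hU]
    refine (mk_biUnion_le _ _).trans (mul_le_mul' hcon.1 (ciSup_le' fun y => ?_))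
    by_contra hy
    exact hcon.2 ⟨y.1, hy, y.2⟩
  exact (mk_le_mk_of_subset hsub).trans_lt ((mk_union_le _ _).trans_lt
    (add_lt_of_lt (aleph0_le_mk X) hfξ (mk_image_le.trans_lt hgζ)))

theorem mem_monA'_of_injective {X : Type u} [Infinite X] {f : Function.End X}
    (hf : Function.Injective f) : f ∈ monA' X := by
  refine ⟨1, one_lt_aleph0.trans_le (aleph0_le_mk X), ?_⟩
  have hempty : {x : X | ¬ #(f ⁻¹' {x}) ≤ 1} = ∅ := by
    refine Set.eq_empty_iff_forall_notMem.2 fun x hx => hx ?_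
    exact mk_le_one_iff_set_subsingleton.2 (Set.subsingleton_singleton.preimage hf)
  rw [hempty, mk_eq_zero]
  exact aleph0_pos.trans_le (aleph0_le_mk X)

/-- If a fiber of `f ∘ g` with `g` surjective has regular cardinality, then this cardinality is
already attained by a fiber of `f` or of `g`. -/
theorem exists_mk_fiber_eq_of_comp {X : Type u} {f g : X → X} (hg : Function.Surjective g)
    {ξ : Cardinal.{u}} (hξ : ξ.IsRegular) {x : X} (h : #((f ∘ g) ⁻¹' {x}) = ξ) :
    (∃ y, #(f ⁻¹' {y}) = ξ) ∨ ∃ y, #(g ⁻¹' {y}) = ξ := by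
  by_contra! hcon
  have hU : (f ∘ g) ⁻¹' {x} = ⋃ y ∈ f ⁻¹' {x}, g ⁻¹' {y} := by
    ext z
    simp
  have hf : #(f ⁻¹' {x}) < ξ := by
    refine lt_of_le_of_ne ?_ (hcon.1 x)
    rw [← h, ← Set.image_preimage_eq (f ⁻¹' {x}) hg]
    exact mk_image_le
  have hlt := (card_biUnion_lt_iff_forall_of_isRegular (t := fun y _ => g ⁻¹' {y}) hξ hf).2
    fun y hy => lt_of_le_of_ne (h ▸ mk_le_mk_of_subset (by
      rw [hU]
      exact Set.subset_biUnion_of_mem (u := fun y => g ⁻¹' {y}) hy)) (hcon.2 y)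
  rw [← hU, h] at hlt
  exact hlt.false

/-- The surjective members of `A'` for which the indices `i` such that some fiber has
cardinality `c i` are covered by finitely many of the sets `A t` with `t ∈ T`. -/
def coveredSubmonoid {X ι : Type u} [Infinite X] {c : ι → Cardinal.{u}}
    (hreg : ∀ i, (c i).IsRegular) (A : Set ι → Set ι) (T : Set (Set ι)) :
    Submonoid (Function.End X) where
  carrier := {f | Function.Surjective f ∧ f ∈ monA' X ∧ ∃ F ⊆ T, F.Finite ∧
    {i | ∃ y, #(f ⁻¹' {y}) = c i} ⊆ ⋃ s ∈ F, A s}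
  mul_mem' := by
    rintro f g ⟨hf, hf', F, hFT, hF, hFA⟩ ⟨hg, hg', G, hGT, hG, hGA⟩
    refine ⟨hf.comp hg, mul_mem_monA' hf' hg', F ∪ G, Set.union_subset hFT hGT, hF.union hG, ?_⟩
    rintro i ⟨y, hy⟩
    rw [Set.biUnion_union]
    exact (exists_mk_fiber_eq_of_comp hg (hreg i) hy).imp (fun h => hFA h) (fun h => hGA h)
  one_mem' := by
    refine ⟨Function.surjective_id, mem_monA'_of_injective Function.injective_id, ∅,
      Set.empty_subset T, Set.finite_empty, ?_⟩
    rintro i ⟨y, hy⟩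
    have h1 : #((1 : Function.End X) ⁻¹' {y}) = 1 := mk_singleton y
    exact absurd (h1.symm.trans hy) (by simpa using ((hreg i).nat_lt 1).ne)

theorem permSubmonoid_le_coveredSubmonoid {X ι : Type u} [Infinite X] {c : ι → Cardinal.{u}}
    (hreg : ∀ i, (c i).IsRegular) (A : Set ι → Set ι) (T : Set (Set ι)) :
    permSubmonoid X ≤ coveredSubmonoid hreg A T := by
  intro f hf
  refine ⟨hf.2, mem_monA'_of_injective hf.1, ∅, Set.empty_subset T, Set.finite_empty, ?_⟩
  rintro i ⟨y, hy⟩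
  have h1 : #(f ⁻¹' {y}) ≤ 1 :=
    mk_le_one_iff_set_subsingleton.2 (Set.subsingleton_singleton.preimage hf.1)
  exact absurd (hy ▸ h1) (not_le.2 (by simpa using (hreg i).nat_lt 1))

/-- Every set of fewer than `#X` nontrivial fiber sizes is realized by a surjection in `A'`. -/
theorem exists_surjective_mem_monA'_fibers_eq {X ι : Type u} [Infinite X] {c : ι → Cardinal.{u}}
    (hreg : ∀ i, (c i).IsRegular) (hinj : Function.Injective c) (hle : ∀ i, c i ≤ #X)
    (hι : #ι < #X) (A : Set ι) :
    ∃ f : Function.End X, Function.Surjective f ∧ f ∈ monA' X ∧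
      {i | ∃ y, #(f ⁻¹' {y}) = c i} = A := by
  have hX := aleph0_le_mk X
  have hA : #A ≤ #X := (mk_set_le A).trans hι.le
  have hdom : #X = #((Σ i : A, (c i).out) ⊕ X) := by
    rw [mk_sum, lift_id, lift_id, mk_sigma]
    refine (add_eq_right hX ?_).symm
    refine (sum_le_mk_mul_iSup _).trans ((mul_le_mul' hA (ciSup_le' fun i => ?_)).trans_eq
      (mul_eq_self hX))
    simpa using hle i
  have hcod : #(A ⊕ X) = #X := by
    rw [mk_sum, lift_id, lift_id, add_eq_right hX hA]
  obtain ⟨e⟩ := Cardinal.eq.1 hdom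
  obtain ⟨d⟩ := Cardinal.eq.1 hcod
  let p : (Σ i : A, (c i).out) ⊕ X → A ⊕ X := Sum.map Sigma.fst id
  have hp : Function.Surjective p := by
    refine Sum.map_surjective.2 ⟨fun i => ?_, Function.surjective_id⟩
    have : Nonempty (c i).out := mk_ne_zero_iff.1 (by simpa using (hreg i).ne_zero)
    exact ⟨⟨i, Classical.arbitrary _⟩, rfl⟩
  let f : Function.End X := fun x => d (p (e x))
  have hfib : ∀ z, #(f ⁻¹' {d z}) = #(p ⁻¹' {z}) := fun z =>
    mk_congr (e.subtypeEquiv fun x => by simp [f])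
  have hl : ∀ i : A, #(f ⁻¹' {d (Sum.inl i)}) = c i := by
    intro i
    rw [hfib]
    have hset : p ⁻¹' {Sum.inl i} = (fun a : (c i).out => Sum.inl ⟨i, a⟩) '' Set.univ := by
      ext z
      rcases z with ⟨j, a⟩ | x
      · simp only [p, Set.mem_preimage, Sum.map_inl, Set.mem_singleton_iff, Sum.inl.injEq,
          Set.image_univ, Set.mem_range, Sigma.mk.injEq]
        constructor
        · rintro rfl
          exact ⟨a, rfl, HEq.rfl⟩
        · rintro ⟨_, h, _⟩
          exact h.symm
      · simp [p]
    rw [hset, mk_image_eq, mk_univ, mk_out]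
    intro a b hab
    simpa using hab
  have hr : ∀ x, #(f ⁻¹' {d (Sum.inr x)}) = 1 := by
    intro x
    rw [hfib]
    have hset : p ⁻¹' {Sum.inr x} = {Sum.inr x} := by
      ext z
      rcases z with a | y <;> simp [p]
    rw [hset, mk_singleton]
  refine ⟨f, d.surjective.comp (hp.comp e.surjective), ⟨1, one_lt_aleph0.trans_le hX, ?_⟩, ?_⟩
  · have hsub : {x : X | ¬ #(f ⁻¹' {x}) ≤ 1} ⊆ Set.range fun i : A => d (Sum.inl i) := by
      intro x hx
      obtain ⟨z, rfl⟩ := d.surjective x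
      rcases z with i | y
      · exact ⟨i, rfl⟩
      · exact absurd (hr y).le hx
    exact ((mk_le_mk_of_subset hsub).trans mk_range_le).trans_lt ((mk_set_le A).trans_lt hι)
  · ext i
    constructor
    · rintro ⟨y, hy⟩
      obtain ⟨z, rfl⟩ := d.surjective y
      rcases z with j | y
      · rw [hl] at hy
        exact hinj hy ▸ j.2
      · rw [hr] at hy
        have := (hreg i).nat_lt 1
        rw [← hy] at this
        simp at this
    · exact fun hi => ⟨_, hl ⟨i, hi⟩⟩

theorem le_mk_interval {X ι : Type u} [Infinite X] [Infinite ι] {c : ι → Cardinal.{u}}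
    (hreg : ∀ i, (c i).IsRegular) (hinj : Function.Injective c) (hle : ∀ i, c i ≤ #X)
    (hι : #ι < #X) :
    (2 : Cardinal.{u}) ^ ((2 : Cardinal.{u}) ^ #ι) ≤
      #{M : Submonoid (Function.End X) //
        permSubmonoid X ≤ M ∧ (M : Set (Function.End X)) ⊆ monA' X} := by
  obtain ⟨A, hA⟩ := exists_finitely_uncovered_family ι
  choose f hf hf' hfA using exists_surjective_mem_monA'_fibers_eq hreg hinj hle hι
  have hmem : ∀ (T : Set (Set ι)) (t : Set ι), f (A t) ∈ coveredSubmonoid hreg A T ↔ t ∈ T := by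
    intro T t
    constructor
    · rintro ⟨-, -, F, hFT, hF, hFA⟩
      by_contra ht
      rw [hfA] at hFA
      exact hA t F hF (fun h => ht (hFT h)) hFA
    · intro ht
      refine ⟨hf _, hf' _, {t}, Set.singleton_subset_iff.2 ht, Set.finite_singleton t, ?_⟩
      simp [hfA]
  let Φ : Set (Set ι) → {M : Submonoid (Function.End X) //
      permSubmonoid X ≤ M ∧ (M : Set (Function.End X)) ⊆ monA' X} := fun T =>
    ⟨coveredSubmonoid hreg A T, permSubmonoid_le_coveredSubmonoid hreg A T, fun _ h => h.2.1⟩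
  have hΦ : Function.Injective Φ := by
    intro T T' h
    ext t
    rw [← hmem T, ← hmem T', show coveredSubmonoid hreg A T = coveredSubmonoid hreg A T' from
      congrArg Subtype.val h]
  simpa using mk_le_of_injective hΦ

/-- The cardinals up to `ℵ_ α` are indexed by a type of cardinality `max |α| ℵ₀`. -/
theorem exists_index_le_aleph (α : Ordinal.{u}) :
    ∃ (J : Type u) (c : J → Cardinal.{u}), #J = max α.card ℵ₀ ∧
      ∀ ξ ≤ Cardinal.aleph α, ∃ j, c j = ξ := by
  refine ⟨Option α.ToType ⊕ ULift.{u} ℕ, Sum.elim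
    (fun o => o.elim (Cardinal.aleph α) fun i => Cardinal.aleph i.toOrd) (fun n => n.down),
    ?_, fun ξ hξ => ?_⟩
  · simp only [mk_sum, mk_option, mk_toType, lift_id, mk_uLift, mk_nat, lift_aleph0]
    rw [add_assoc, add_eq_right le_rfl one_le_aleph0, add_eq_max' le_rfl]
  · rcases lt_or_ge ξ ℵ₀ with h | h
    · obtain ⟨n, rfl⟩ := lt_aleph0.1 h
      exact ⟨Sum.inr ⟨n⟩, rfl⟩
    · obtain ⟨β, rfl⟩ := mem_range_aleph_iff.2 h
      rcases (aleph_le_aleph.1 hξ).lt_or_eq with hβ | rfl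
      · exact ⟨Sum.inl (some (Ordinal.ToType.mk ⟨β, hβ⟩)), by simp⟩
      · exact ⟨Sum.inl none, rfl⟩

/-- On an infinite set of singular cardinality `κ = ℵ_α` with `λ = max(|α|, ℵ₀) < κ`,
the interval `[S, A']` has cardinality `2^(2^λ)`. -/
theorem card_interval_S_A'_singular_small_lambda {X : Type u} [Infinite X] {α : Ordinal.{u}}
    (hκ : #X = Cardinal.aleph α) (hsing : ¬(Cardinal.aleph α).IsRegular)
    (lam : Cardinal.{u}) (hlam : lam = max α.card ℵ₀) (hlt : lam < Cardinal.aleph α) :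
    #{M : Submonoid (Function.End X) //
        permSubmonoid X ≤ M ∧ (M : Set (Function.End X)) ⊆ monA' X} =
      (2 : Cardinal.{u}) ^ ((2 : Cardinal.{u}) ^ lam) := by
  subst hlam
  have hlim : Order.IsSuccLimit α :=
    (IsSingular.of_not_isRegular (aleph0_le_aleph α) hsing).isSuccLimit_of_aleph
  have hcard : ℵ₀ ≤ α.card := Ordinal.aleph0_le_card.2 (Ordinal.omega0_le_of_isSuccLimit hlim)
  apply le_antisymm
  · obtain ⟨J, c, hJ, hc⟩ := exists_index_le_aleph α
    have : Infinite J := infinite_iff.2 (hJ ▸ le_max_right _ _)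
    rw [← hJ]
    exact mk_interval_le c (hκ ▸ hc) fun M => (M : Set (Function.End X)) ⊆ monA' X
  · rw [max_eq_left hcard, ← mk_toType α]
    have : Infinite α.ToType := infinite_iff.2 (by rwa [mk_toType])
    refine le_mk_interval (c := fun i : α.ToType => Cardinal.aleph (i.toOrd + 1 : Ordinal))
      (fun i => isRegular_aleph_add_one _) (fun i j h => ?_) (fun i => ?_) ?_
    · exact Ordinal.ToType.mk.symm.injective (Subtype.ext (by simpa using h))
    · rw [hκ, aleph_le_aleph]
      exact Order.add_one_le_of_lt i.toOrd.2
    · rw [mk_toType, hκ]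
      exact (le_max_left _ _).trans_lt hlt
end

section
/- Let X be an infinite set of singular cardinality κ = ℵ_α with λ = max(|α|, ℵ₀) < κ, and let D be the intersection of all precomplete submonoids of O^(1) containing the permutations. Then the interval [S, D] has cardinality 2^(2^λ). -/
open Cardinal

universe u

/-- The number of fibers of `f` (possibly empty) of cardinality `ξ`. -/
noncomputable def fiberCount {X : Type u} (f : X → X) (ξ : Cardinal.{u}) : Cardinal.{u} :=
  #{y : X // #(f ⁻¹' {y}) = ξ}

/-- Functions with the same number of fibers of each cardinality are equal up to composition with
permutations on both sides. -/
theorem exists_perm_comp_of_fiberCount_eq {X : Type u} {f g : X → X}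
    (h : ∀ ξ, fiberCount f ξ = fiberCount g ξ) :
    ∃ σ τ : Equiv.Perm X, g = σ ∘ f ∘ τ := by
  let e : ∀ ξ, {y : X // #(f ⁻¹' {y}) = ξ} ≃ {y : X // #(g ⁻¹' {y}) = ξ} :=
    fun ξ => (Cardinal.eq.1 (h ξ)).some
  let σ : Equiv.Perm X := (Equiv.sigmaFiberEquiv (fun y => #(f ⁻¹' {y}))).symm.trans
    ((Equiv.sigmaCongrRight e).trans (Equiv.sigmaFiberEquiv (fun y => #(g ⁻¹' {y}))))
  have hσ : ∀ y, #(f ⁻¹' {y}) = #(g ⁻¹' {σ y}) := fun y => (e _ ⟨y, rfl⟩).2.symm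
  let T : ∀ y, {x // f x = y} ≃ {x // g x = σ y} := fun y => (Cardinal.eq.1 (hσ y)).some
  let τ : Equiv.Perm X := (Equiv.sigmaFiberEquiv f).symm.trans
    ((Equiv.sigmaCongr σ T).trans (Equiv.sigmaFiberEquiv g))
  have hτ : ∀ x, g (τ x) = σ (f x) := fun x => (T _ ⟨x, rfl⟩).2
  refine ⟨σ, τ.symm, funext fun x => ?_⟩
  simpa using hτ (τ.symm x)

/-- There are `max |α| ℵ₀` cardinals below `ℵ_α`. -/
theorem mk_Iic_aleph (α : Ordinal.{u}) :
    #(Set.Iic (ℵ_ α)) = Cardinal.lift.{u + 1} (max α.card ℵ₀) := by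
  have h : Set.Iic (ℵ_ α) = preAleph '' Set.Iio (Order.succ (Ordinal.omega0 + α)) := by
    ext c
    obtain ⟨o, rfl⟩ := preAleph.surjective c
    simp [aleph_eq_preAleph]
  rw [h, mk_image_eq preAleph.injective, mk_Iio_ordinal]
  congr 1
  rw [Order.succ_eq_add_one, Ordinal.card_add_one, Ordinal.card_add, Ordinal.card_omega0,
    add_eq_max le_rfl, max_comm]
  exact add_eq_left (le_max_right _ _) (one_le_aleph0.trans (le_max_right _ _))

/-- There are at most `2 ^ 2 ^ max |α| ℵ₀` submonoids containing all permutations. -/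
theorem mk_submonoid_perm_le {X : Type u} {α : Ordinal.{u}} (hκ : #X = ℵ_ α)
    (D : Submonoid (Function.End X)) :
    #{M : Submonoid (Function.End X) // permSubmonoid X ≤ M ∧ M ≤ D} ≤
      (2 : Cardinal.{u}) ^ ((2 : Cardinal.{u}) ^ max α.card ℵ₀) := by
  let K := Set.Iic (ℵ_ α)
  let t : Function.End X → K → K := fun f ξ => ⟨fiberCount f ξ, (mk_subtype_le _).trans hκ.le⟩
  have ht : ∀ f g : Function.End X, t f = t g → ∃ σ τ : Equiv.Perm X, g = σ ∘ f ∘ τ := by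
    intro f g h
    refine exists_perm_comp_of_fiberCount_eq fun ξ => ?_
    by_cases hξ : ξ ≤ ℵ_ α
    · exact congrArg Subtype.val (congrFun h ⟨ξ, hξ⟩)
    · have h0 : ∀ f : X → X, fiberCount f ξ = 0 := fun f => by
        refine mk_eq_zero_iff.2 ⟨fun y => hξ ?_⟩
        rw [← y.2, ← hκ]
        exact mk_set_le _
      exact (h0 f).trans (h0 g).symm
  have hmem : ∀ M : Submonoid (Function.End X), permSubmonoid X ≤ M →
      ∀ f g, t f = t g → f ∈ M → g ∈ M := by
    intro M hM f g hfg hf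
    obtain ⟨σ, τ, rfl⟩ := ht f g hfg
    exact M.mul_mem (hM σ.bijective) (M.mul_mem hf (hM τ.bijective))
  let Φ : {M : Submonoid (Function.End X) // permSubmonoid X ≤ M ∧ M ≤ D} → Set (K → K) :=
    fun M => t '' (M.1 : Set (Function.End X))
  have hle : ∀ M N : {M : Submonoid (Function.End X) // permSubmonoid X ≤ M ∧ M ≤ D},
      Φ M = Φ N → M.1 ≤ N.1 := by
    intro M N h f hf
    have : t f ∈ Φ N := h ▸ Set.mem_image_of_mem t hf
    obtain ⟨g, hg, hgf⟩ := this
    exact hmem N.1 N.2.1 g f hgf hg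
  have hΦ : Function.Injective Φ := fun M N h =>
    Subtype.ext (le_antisymm (hle M N h) (hle N M h.symm))
  have := lift_mk_le_lift_mk_of_injective hΦ
  rw [mk_set, mk_arrow] at this
  have hK : #K = Cardinal.lift.{u + 1} (max α.card ℵ₀) := mk_Iic_aleph α
  rw [lift_id'.{u, u + 1}, hK, power_self_eq (by simp)] at this
  rw [← lift_le.{u + 1}]
  simpa using this

/-- The range of `a ∘ b` is at most as large as the range of `b`. -/
theorem mk_range_comp_le_right {X Y Z : Type u} (a : Y → Z) (b : X → Y) :
    #(Set.range (a ∘ b)) ≤ #(Set.range b) := by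
  rw [Set.range_comp]
  exact mk_image_le

/-- Every function of range smaller than `X` lies in every precomplete submonoid. -/
theorem Precomplete.mem_of_mk_range_lt {X : Type u} [Infinite X] {C : Submonoid (Function.End X)}
    (hC : Precomplete C) {f : Function.End X} (hf : #(Set.range f) < #X) : f ∈ C := by
  by_contra hfC
  let N : Submonoid (Function.End X) :=
    { carrier := {g | g ∈ C ∨ #(Set.range g) < #X}
      one_mem' := Or.inl C.one_mem
      mul_mem' := by
        rintro a b (ha | ha) hb
        · rcases hb with hb | hb
          · exact Or.inl (C.mul_mem ha hb)
          · right
            exact (mk_range_comp_le_right a b).trans_lt hb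
        · right
          exact (mk_le_mk_of_subset (Set.range_comp_subset_range b a)).trans_lt ha }
  have hN : N = ⊤ := by
    rw [eq_top_iff, ← hC.2 f hfC, Submonoid.closure_le]
    rintro g (hg | rfl)
    · exact Or.inl hg
    · exact Or.inr hf
  have hlarge : ∀ g : Function.End X, #X ≤ #(Set.range g) → g ∈ C := by
    intro g hg
    have : g ∈ N := hN ▸ Submonoid.mem_top g
    exact this.resolve_right hg.not_gt
  apply hC.1
  rw [eq_top_iff]
  rintro g -
  obtain ⟨e⟩ : Nonempty (X ⊕ X ≃ X) := Cardinal.eq.1 (by simp)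
  have hfac : g = (fun x => Sum.elim g id (e.symm x) : X → X) ∘ (fun x => e (Sum.inl x)) := by
    funext x
    change g x = Sum.elim g id (e.symm (e (Sum.inl x)))
    rw [Equiv.symm_apply_apply]
    rfl
  rw [hfac]
  refine C.mul_mem (hlarge _ ?_) (hlarge _ ?_)
  · rw [Set.range_eq_univ.2, mk_univ]
    exact fun x => ⟨e (Sum.inr x), by rw [Equiv.symm_apply_apply]; rfl⟩
  · exact (mk_range_eq _ (e.injective.comp Sum.inl_injective)).ge

/-- The submonoid of all permutations together with those functions of small range for which
some member `B` of `𝓕` contains every `j` such that a preimage of some set has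
cardinality `c j`. -/
def preimageSubmonoid (X : Type u) {J : Type u} (c : J → Cardinal.{u}) (𝓕 : Set (Set J)) :
    Submonoid (Function.End X) where
  carrier := {f | Function.Bijective f ∨
    #(Set.range f) < #X ∧ ∃ B ∈ 𝓕, ∀ (Z : Set X) (j : J), #(f ⁻¹' Z) = c j → j ∈ B}
  one_mem' := Or.inl Function.bijective_id
  mul_mem' := by
    rintro a b ha (hb | ⟨hb, B, hB, hbB⟩)
    · rcases ha with ha | ⟨ha, B, hB, haB⟩
      · exact Or.inl (ha.comp hb)
      · refine Or.inr ⟨?_, B, hB, fun Z j h => haB Z j ?_⟩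
        · exact (mk_le_mk_of_subset (Set.range_comp_subset_range b a)).trans_lt ha
        · rw [← h]
          exact (mk_preimage_of_injective_of_subset_range b (a ⁻¹' Z) hb.1
            (by simp [hb.2.range_eq])).symm
    · refine Or.inr ⟨?_, B, hB, fun Z j h => hbB (a ⁻¹' Z) j h⟩
      exact (mk_range_comp_le_right a b).trans_lt hb

/-- For a set `B` of indices of alephs below `#X`, there is a function of small range
having fibers of cardinality `ℵ_ (o j + 1)` for `j ∈ B`, such that no preimage of a set has
cardinality `ℵ_ (o j + 1)` for `j ∉ B`. -/
theorem exists_function_preimage_card {X J : Type u} {α : Ordinal.{u}} (hκ : #X = ℵ_ α)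
    (hα : Order.IsSuccLimit α) (hJ : #J < #X) {o : J → Ordinal.{u}}
    (ho : Function.Injective o) (hoα : ∀ j, o j < α) (B : Set J) :
    ∃ f : X → X, #(Set.range f) < #X ∧ (∀ j ∈ B, ∃ Z : Set X, #(f ⁻¹' Z) = ℵ_ (o j + 1)) ∧
      ∀ (Z : Set X) (j : J), #(f ⁻¹' Z) = ℵ_ (o j + 1) → j ∈ B := by
  have hX : ℵ₀ ≤ #X := hκ ▸ aleph0_le_aleph α
  have hlt : ∀ j, ℵ_ (o j + 1) < #X := fun j => by
    rw [hκ, aleph_lt_aleph]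
    exact hα.succ_lt (hoα j)
  let P : Option B → Type u := fun i => i.elim X fun j => (ℵ_ (o j + 1)).out
  have hP : ∀ j : B, #(P (some j)) = ℵ_ (o j + 1) := fun j => mk_out _
  have hPle : ∀ i, #(P i) ≤ #X := by
    rintro (_ | j)
    · exact le_rfl
    · rw [hP]; exact (hlt j).le
  have hopt : #(Option B) < #X := by
    rw [mk_option]
    exact add_lt_of_lt hX ((mk_set_le B).trans_lt hJ) (one_lt_aleph0.trans_le hX)
  obtain ⟨e⟩ : Nonempty (X ≃ Σ i, P i) := by
    refine Cardinal.eq.1 (le_antisymm ?_ ?_)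
    · exact mk_le_of_injective (f := Sigma.mk (β := P) none) sigma_mk_injective
    · rw [mk_sigma]
      refine (sum_le_sum _ _ hPle).trans ?_
      rw [sum_const, lift_id, lift_id]
      exact (mul_le_mul_left hopt.le _).trans (mul_eq_self hX).le
  obtain ⟨ι⟩ : Nonempty (Option B ↪ X) := hopt.le
  let f : X → X := fun x => ι (e x).1
  have hpre : ∀ Z : Set X, #(f ⁻¹' Z) = Cardinal.sum fun i : ι ⁻¹' Z => #(P i) := by
    intro Z
    rw [← mk_sigma]
    refine mk_congr ((e.subtypeEquiv (q := fun p => ι p.1 ∈ Z) fun x => Iff.rfl).trans ?_)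
    exact Equiv.subtypeSigmaEquiv P (fun i => ι i ∈ Z)
  have hpiece : ∀ (Z : Set X) (i : Option B), ι i ∈ Z → #(P i) ≤ #(f ⁻¹' Z) := fun Z i hi => by
    rw [hpre]
    exact le_sum (fun i : ι ⁻¹' Z => #(P i)) ⟨i, hi⟩
  refine ⟨f, ?_, fun j hj => ⟨{ι (some ⟨j, hj⟩)}, ?_⟩, fun Z j hZ => ?_⟩
  · exact ((mk_le_mk_of_subset (Set.range_comp_subset_range (fun x => (e x).1) ι)).trans
      mk_range_le).trans_lt hopt
  · rw [hpre]
    have : ι ⁻¹' {ι (some ⟨j, hj⟩)} = {some ⟨j, hj⟩} := by ext; simp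
    rw [this, ← mk_sigma,
      mk_congr (Equiv.uniqueSigma fun i : ({some ⟨j, hj⟩} : Set (Option B)) => P i)]
    exact hP _
  · by_contra hjB
    have hbelow : ∀ i : ι ⁻¹' Z, ∃ k : B, i.1 = some k ∧ o k < o j := by
      rintro ⟨_ | k, hi⟩
      · exact absurd (hpiece Z none hi) (by rw [hZ]; exact (hlt j).not_ge)
      · refine ⟨k, rfl, lt_of_le_of_ne ?_ fun h => hjB (ho h ▸ k.2)⟩
        have := hpiece Z _ hi
        rw [hP, hZ, aleph_le_aleph] at this
        exact Order.succ_le_succ_iff.1 this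
    choose k hk hkj using hbelow
    have hcard : #(ι ⁻¹' Z) ≤ ℵ_ (o j) := by
      have hinj : Function.Injective
          (fun i => ⟨o (k i), hkj i⟩ : ι ⁻¹' Z → Set.Iio (o j)) := by
        intro i i' h
        have h' : k i = k i' := Subtype.ext (ho (congrArg Subtype.val h))
        exact Subtype.ext (by rw [hk, hk, h'])
      have := lift_mk_le_lift_mk_of_injective hinj
      rw [mk_Iio_ordinal, lift_id'.{u, u + 1}, lift_le] at this
      refine this.trans ?_
      rw [← Ordinal.card_omega]
      exact Ordinal.card_le_card (Ordinal.le_omega_self _)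
    have hsum : #(f ⁻¹' Z) ≤ ℵ_ (o j) := by
      rw [hpre]
      refine (sum_le_sum _ (fun _ => ℵ_ (o j)) fun i => ?_).trans ?_
      · rw [hk i, hP, aleph_le_aleph]
        exact Order.succ_le_of_lt (hkj i)
      · rw [sum_const, lift_id, lift_id]
        exact (mul_le_mul_left hcard _).trans (mul_eq_self (aleph0_le_aleph _)).le
    rw [hZ, aleph_le_aleph] at hsum
    exact (Order.lt_succ (o j)).not_ge hsum

/-- An infinite type `J` has an antichain of `2 ^ #J` subsets. -/
theorem exists_antichain_sets (J : Type u) [Infinite J] :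
    ∃ B : Set J → Set J, ∀ s t, B s ⊆ B t → s = t := by
  obtain ⟨e⟩ : Nonempty (J ⊕ J ≃ J) := Cardinal.eq.1 (by simp)
  refine ⟨fun s => e '' (Sum.inl '' s ∪ Sum.inr '' sᶜ), fun s t h => ?_⟩
  rw [Set.image_subset_image_iff e.injective] at h
  ext j
  constructor
  · intro hj
    simpa using h (Or.inl ⟨j, hj, rfl⟩)
  · intro hj
    by_contra hjs
    exact (show j ∉ t by simpa using h (Or.inr ⟨j, hjs, rfl⟩)) hj

/-- On an infinite set of singular cardinality `κ = ℵ_α` with `λ = max(|α|, ℵ₀) < κ`, the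
interval `[S, D]` has cardinality `2^(2^λ)`, where `D` is the intersection of all precomplete
submonoids containing the permutations. -/
theorem card_interval_S_D_singular_small_lambda {X : Type u} [Infinite X] {α : Ordinal.{u}}
    (hκ : #X = Cardinal.aleph α) (hsing : ¬(Cardinal.aleph α).IsRegular)
    (lam : Cardinal.{u}) (hlam : lam = max α.card ℵ₀) (hlt : lam < Cardinal.aleph α)
    (D : Submonoid (Function.End X))
    (hD : D = sInf {C : Submonoid (Function.End X) | Precomplete C ∧ permSubmonoid X ≤ C}) :
    #{M : Submonoid (Function.End X) // permSubmonoid X ≤ M ∧ M ≤ D} =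
      (2 : Cardinal.{u}) ^ ((2 : Cardinal.{u}) ^ lam) := by
  have hα : Order.IsSuccLimit α := by
    rcases Ordinal.zero_or_succ_or_isSuccLimit α with rfl | ⟨β, rfl⟩ | h
    · exact absurd (aleph_zero ▸ isRegular_aleph0) hsing
    · exact absurd (isRegular_aleph_add_one β) hsing
    · exact h
  have hcard : ℵ₀ ≤ α.card := by
    simpa using Ordinal.omega0_le_of_isSuccLimit hα
  have hlamα : lam = α.card := hlam.trans (max_eq_left hcard)
  refine le_antisymm (hlam ▸ mk_submonoid_perm_le hκ D) ?_
  have hJ : #α.ToType = lam := by rw [mk_toType, hlamα]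
  have : Infinite α.ToType := by rwa [infinite_iff, mk_toType]
  let o : α.ToType → Ordinal.{u} := fun j => (Ordinal.ToType.mk.symm j : Set.Iio α)
  have ho : Function.Injective o := Subtype.val_injective.comp (OrderIso.injective _)
  have hoα : ∀ j, o j < α := fun j => (Ordinal.ToType.mk.symm j : Set.Iio α).2
  obtain ⟨B, hB⟩ := exists_antichain_sets α.ToType
  choose f hfrange hffiber hfpre using fun s : Set α.ToType =>
    exists_function_preimage_card hκ hα (by rwa [hJ, hκ]) ho hoα (B s)
  let c : α.ToType → Cardinal.{u} := fun j => ℵ_ (o j + 1)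
  let M : Set (Set α.ToType) → Submonoid (Function.End X) :=
    fun 𝓐 => preimageSubmonoid X c (B '' 𝓐)
  have hM : ∀ 𝓐, permSubmonoid X ≤ M 𝓐 ∧ M 𝓐 ≤ D := by
    refine fun 𝓐 => ⟨fun g hg => Or.inl hg, ?_⟩
    rw [hD]
    refine le_sInf fun C hC g hg => ?_
    rcases hg with hg | hg
    · exact hC.2 hg
    · exact hC.1.mem_of_mk_range_lt hg.1
  have hmem : ∀ 𝓐 s, f s ∈ M 𝓐 ↔ s ∈ 𝓐 := by
    intro 𝓐 s
    constructor
    · rintro (h | ⟨-, _, ⟨t, ht, rfl⟩, h⟩)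
      · exact absurd (hfrange s) (by rw [h.2.range_eq, mk_univ]; exact lt_irrefl _)
      · have hst : s = t := hB s t fun j hj => by
          obtain ⟨Z, hZ⟩ := hffiber s j hj
          exact h Z j hZ
        exact hst ▸ ht
    · exact fun hs => Or.inr ⟨hfrange s, B s, ⟨s, hs, rfl⟩, hfpre s⟩
  have hinj : Function.Injective fun 𝓐 => (⟨M 𝓐, hM 𝓐⟩ :
      {M : Submonoid (Function.End X) // permSubmonoid X ≤ M ∧ M ≤ D}) := by
    intro 𝓐 𝓑 h
    have h' : M 𝓐 = M 𝓑 := congrArg Subtype.val h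
    ext s
    rw [← hmem, ← hmem, h']
  have := mk_le_of_injective hinj
  rwa [mk_set, mk_set, hJ] at this
end

section
/- Let X be an infinite set of cardinality κ, and let f, g : X → X be functions with equal kernel sequences, s_f = s_g, and with |X \ f[X]| = |X \ g[X]|. Then there exist permutations β, γ of X such that f = β ∘ g ∘ γ. -/
open Cardinal

universe u

/-- Two maps whose fibers over every point are equinumerous differ by an equivalence
of their domains. -/
theorem exists_equiv_comp_eq_of_mk_fiber_eq_s10 {α β : Type u} {γ : Type*} (f : α → γ) (g : β → γ)
    (h : ∀ c, #{a // f a = c} = #{b // g b = c}) : ∃ e : α ≃ β, g ∘ e = f :=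
  ⟨Equiv.ofFiberEquiv fun c => (Cardinal.eq.1 (h c)).some,
    funext fun a => Equiv.ofFiberEquiv_map _ a⟩

theorem mk_fiber_eq_zero_iff {α β : Type u} (f : α → β) (y : β) :
    #(f ⁻¹' {y}) = 0 ↔ y ∈ (Set.range f)ᶜ := by
  rw [Cardinal.mk_set_eq_zero_iff, Set.preimage_singleton_eq_empty, Set.mem_compl_iff]

/-- For `ξ ≠ 0`, the kernel sequence at `ξ` counts the points whose fiber has cardinality `ξ`. -/
theorem mk_fiber_card_eq_kernelSeq {X : Type u} (f : X → X) {ξ : Cardinal.{u}} (hξ : ξ ≠ 0) :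
    #{y // #(f ⁻¹' {y}) = ξ} = kernelSeq f ξ := by
  have hne : ∀ y, #(f ⁻¹' {y}) = ξ → (f ⁻¹' {y}).Nonempty := fun y hy => by
    rw [← Set.nonempty_coe_sort, ← Cardinal.mk_ne_zero_iff, hy]
    exact hξ
  refine Cardinal.mk_congr (Equiv.ofBijective
    (fun y => ⟨f ⁻¹' {y.1}, ⟨y.1, rfl⟩, hne _ y.2, y.2⟩) ⟨?_, ?_⟩)
  · rintro ⟨y, hy⟩ ⟨z, hz⟩ h
    have h' : f ⁻¹' {y} = f ⁻¹' {z} := congrArg Subtype.val h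
    obtain ⟨x, hx⟩ := hne y hy
    have hx' : x ∈ f ⁻¹' {z} := h' ▸ hx
    exact Subtype.ext (Eq.trans (Eq.symm hx) hx')
  · rintro ⟨_, ⟨y, rfl⟩, _, hy⟩
    exact ⟨⟨y, hy⟩, rfl⟩

/-- If two functions on an infinite set have the same kernel sequence and the complements of
their ranges have the same cardinality, then they differ by permutations on both sides. -/
theorem eq_comp_perms_of_kernelSeq_eq {X : Type u} [Infinite X] (f g : X → X)
    (hks : kernelSeq f = kernelSeq g)
    (hr : #((Set.range f)ᶜ : Set X) = #((Set.range g)ᶜ : Set X)) :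
    ∃ β γ : Equiv.Perm X, f = β ∘ g ∘ γ := by
  have hcard : ∀ ξ : Cardinal.{u}, #{y // #(f ⁻¹' {y}) = ξ} = #{y // #(g ⁻¹' {y}) = ξ} := by
    intro ξ
    rcases eq_or_ne ξ 0 with rfl | hξ
    · simpa only [mk_fiber_eq_zero_iff] using hr
    · rw [mk_fiber_card_eq_kernelSeq f hξ, mk_fiber_card_eq_kernelSeq g hξ, hks]
  obtain ⟨σ, hσ⟩ := exists_equiv_comp_eq_of_mk_fiber_eq_s10 _ _ hcard
  obtain ⟨γ, hγ⟩ := exists_equiv_comp_eq_of_mk_fiber_eq_s10 f (σ.symm ∘ g) fun c => by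
    simp only [Function.comp_apply, Equiv.symm_apply_eq]
    exact (congrFun hσ c).symm
  exact ⟨σ.symm, γ, hγ.symm⟩
end

section
/- Let X be an infinite set of cardinality κ, let A ⊆ R be unbounded, let f_A : X → X be a function whose kernel sequence satisfies s_{f_A}(ξ) = 1 for ξ ∈ A and s_{f_A}(ξ) = 0 for all cardinals ξ ≤ κ with ξ ∉ A, and let g : X → X be arbitrary. Then the restricted kernel sequences satisfy s̃_{g∘f_A}(ξ) ≤ s̃_{f_A}(ξ) for every ξ ∈ R. -/
open Cardinal

universe u

/-- A family of pairwise distinct cardinals bounded by an infinite cardinal `μ` has at most `μ`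
members. -/
theorem mk_le_of_injective_of_le {ι : Type u} {s : ι → Cardinal.{u}} {μ : Cardinal.{u}}
    (hμ : ℵ₀ ≤ μ) (hs : Function.Injective s) (h : ∀ i, s i ≤ μ) : #ι ≤ μ := by
  have hmem : ∀ i, (s i).ord ∈ Set.Iio (μ.ord + 1) := fun i =>
    Order.lt_add_one_iff.2 (ord_le_ord.2 (h i))
  have hinj : Function.Injective fun i => Ordinal.ToType.mk ⟨(s i).ord, hmem i⟩ := fun a b hab =>
    hs (ord_injective (Subtype.ext_iff.1 (Ordinal.ToType.mk.injective hab)))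
  calc #ι ≤ #(μ.ord + 1).ToType := mk_le_of_injective hinj
    _ = μ + 1 := by rw [mk_toType, Ordinal.card_add_one, card_ord]
    _ = μ := add_one_eq hμ

/-- Pairwise distinct elements of `setR κ n` below a given element of `setR κ n` have a smaller
sum than that element. -/
theorem sum_lt_of_mem_setR {κ : Cardinal.{u}} {n : ℕ → ℕ}
    (hn : ∀ i, (∑ j ∈ Finset.range i, n j) < n i) {ξ : Cardinal.{u}} (hξ : ξ ∈ setR κ n)
    {ι : Type u} {s : ι → Cardinal.{u}} (hs : Function.Injective s)
    (hsR : ∀ i, s i ∈ setR κ n) (hlt : ∀ i, s i < ξ) : Cardinal.sum s < ξ := by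
  rcases hξ with ⟨k, rfl⟩ | ⟨hinf, -, μ, rfl⟩
  · have hex : ∀ i, ∃ j, s i = n j ∧ j < k := by
      intro i
      rcases hsR i with ⟨j, hj⟩ | ⟨hi, -⟩
      · refine ⟨j, hj.symm, ?_⟩
        by_contra! hkj
        have hjk : n j < n k := by
          have h := hlt i
          rw [← hj] at h
          exact Nat.cast_lt.1 h
        rcases hkj.eq_or_lt with rfl | hkj
        · exact hjk.false
        · have := Finset.single_le_sum (f := n) (fun _ _ => Nat.zero_le _)
            (Finset.mem_range.2 hkj)
          have := hn j
          omega
      · exact absurd ((hi.trans_lt (hlt i)).trans natCast_lt_aleph0) (lt_irrefl _)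
    choose j hj hjk using hex
    have hinj : Function.Injective j := fun a b hab => hs (by rw [hj, hj, hab])
    have : Finite ι := Finite.of_injective (fun i => (⟨j i, hjk i⟩ : Fin k))
      fun a b hab => hinj (Fin.ext_iff.1 hab)
    have := Fintype.ofFinite ι
    have hsum : Cardinal.sum s = ((∑ i, n (j i) : ℕ) : Cardinal.{u}) := by
      have h : #(Σ i, ULift.{u} (Fin (n (j i)))) = Cardinal.sum s := by
        rw [mk_sigma]
        exact congrArg Cardinal.sum (funext fun i => by simp [hj])
      rw [← h, mk_fintype]
      simp
    rw [hsum]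
    refine Nat.cast_lt.2 (lt_of_le_of_lt ?_ (hn k))
    rw [← Finset.sum_image (f := n) (s := Finset.univ) (g := j) hinj.injOn]
    refine Finset.sum_le_sum_of_subset fun m hm => ?_
    obtain ⟨i, -, rfl⟩ := Finset.mem_image.1 hm
    exact Finset.mem_range.2 (hjk i)
  · have hμ : ℵ₀ ≤ μ := by
      by_contra! h
      exact hinf.not_gt (isSuccLimit_aleph0.succ_lt h)
    have hle : ∀ i, s i ≤ μ := fun i => Order.lt_succ_iff.1 (hlt i)
    refine Order.lt_succ_of_le ?_
    calc Cardinal.sum s ≤ Cardinal.sum fun _ : ι => μ := sum_le_sum _ _ hle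
      _ = #ι * μ := sum_const' ι μ
      _ ≤ μ * μ := mul_le_mul_left (mk_le_of_injective_of_le hμ hs hle) μ
      _ = μ := mul_eq_self hμ

/-- If every fiber of `g ∘ f` of cardinality `ξ` contains a fiber of `f` of cardinality `ξ`, then
`g ∘ f` has at most as many fibers of cardinality `ξ` as `f`. -/
theorem kernelSeq_comp_le_of_exists_fiber {X : Type u} (f g : X → X) {ξ : Cardinal.{u}}
    (h : ∀ y, #((g ∘ f) ⁻¹' {y}) = ξ → ∃ x ∈ (g ∘ f) ⁻¹' {y}, #(f ⁻¹' {f x}) = ξ) :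
    kernelSeq (g ∘ f) ξ ≤ kernelSeq f ξ := by
  have hex : ∀ B : {B : Set X // (∃ y, B = (g ∘ f) ⁻¹' {y}) ∧ B.Nonempty ∧ #B = ξ},
      ∃ x, B.1 = (g ∘ f) ⁻¹' {g (f x)} ∧ #(f ⁻¹' {f x}) = ξ := by
    rintro ⟨_, ⟨y, rfl⟩, -, hB⟩
    obtain ⟨x, rfl, hx⟩ := h y hB
    exact ⟨x, rfl, hx⟩
  choose x hB hx using hex
  refine mk_le_of_injective
    (f := fun B => ⟨f ⁻¹' {f (x B)}, ⟨_, rfl⟩, ⟨x B, rfl⟩, hx B⟩) fun B C hBC => ?_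
  have hmem : x B ∈ f ⁻¹' {f (x C)} := (Subtype.ext_iff.1 hBC).subset rfl
  exact Subtype.ext (by rw [hB, hB, show f (x B) = f (x C) from hmem])

/-- If `A ⊆ R` is unbounded and `f_A` has kernel sequence the indicator function of `A`,
then for every `g`, the kernel sequence of `g ∘ f_A` is bounded by that of `f_A` on `R`. -/
theorem kernelSeq_comp_le_on_setR {X : Type u} [Infinite X] (n : ℕ → ℕ)
    (hn : ∀ i, (∑ j ∈ Finset.range i, n j) < n i)
    (A : Set Cardinal.{u}) (hAR : A ⊆ setR #X n)
    (hAub : setSum A = Cardinal.lift.{u + 1} #X)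
    (fA : X → X)
    (hfA1 : ∀ ξ ∈ A, kernelSeq fA ξ = 1)
    (hfA0 : ∀ ξ : Cardinal.{u}, ξ ≤ #X → ξ ∉ A → kernelSeq fA ξ = 0)
    (g : X → X) :
    ∀ ξ ∈ setR #X n, kernelSeq (g ∘ fA) ξ ≤ kernelSeq fA ξ := by
  intro ξ hξ
  have fiber_mem : ∀ z ∈ Set.range fA, #(fA ⁻¹' {z}) ∈ A := by
    rintro z ⟨x, hx⟩
    by_contra hz
    have h0 := hfA0 _ (mk_set_le _) hz
    rw [kernelSeq, mk_eq_zero_iff] at h0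
    exact h0.elim ⟨fA ⁻¹' {z}, ⟨z, rfl⟩, ⟨x, hx⟩, rfl⟩
  have fiber_inj : Set.InjOn (fun z => #(fA ⁻¹' {z})) (Set.range fA) := by
    rintro z ⟨x, hx⟩ w ⟨y, hy⟩ hzw
    have h1 := (hfA1 _ (fiber_mem w ⟨y, hy⟩)).le
    rw [kernelSeq, le_one_iff_subsingleton] at h1
    have h2 := congrArg Subtype.val (h1.elim ⟨fA ⁻¹' {z}, ⟨z, rfl⟩, ⟨x, hx⟩, hzw⟩
      ⟨fA ⁻¹' {w}, ⟨w, rfl⟩, ⟨y, hy⟩, rfl⟩)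
    have h3 : x ∈ fA ⁻¹' {w} := h2.subset hx
    exact hx.symm.trans h3
  refine kernelSeq_comp_le_of_exists_fiber fA g fun y hy => ?_
  by_contra! hne
  have hlt : ∀ z : fA '' ((g ∘ fA) ⁻¹' {y}), #(fA ⁻¹' {(z : X)}) < ξ := by
    rintro ⟨_, x, hx, rfl⟩
    refine lt_of_le_of_ne (hy ▸ mk_le_mk_of_subset ?_) (hne x hx)
    intro x' hx'
    exact (congrArg g hx').trans hx
  have hrange : ∀ z : fA '' ((g ∘ fA) ⁻¹' {y}), (z : X) ∈ Set.range fA :=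
    fun z => Set.image_subset_range _ _ z.2
  refine (sum_lt_of_mem_setR hn hξ (fun z z' h => Subtype.ext (fiber_inj (hrange z) (hrange z') h))
    (fun z => hAR (fiber_mem _ (hrange z))) hlt).not_ge ?_
  rw [← hy]
  refine (mk_le_mk_of_subset ?_).trans (mk_iUnion_le_sum_mk (f := fun
    z : fA '' ((g ∘ fA) ⁻¹' {y}) => fA ⁻¹' {(z : X)}))
  intro x hx
  exact Set.mem_iUnion.2 ⟨⟨fA x, x, hx, rfl⟩, rfl⟩
end

section
/- Let X be an infinite set of cardinality κ, let A, A_1, …, A_n ⊆ R be unbounded with A ⊄ A_i for all 1 ≤ i ≤ n, and let f_A, f_{A_1}, …, f_{A_n} : X → X be functions whose kernel sequences are the indicator functions of A, A_1, …, A_n respectively (value 1 on the set, 0 on all other cardinals ≤ κ). Then f_A does not belong to the submonoid of O^(1) generated by S ∪ {f_{A_1}, …, f_{A_n}}. -/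
open Cardinal

universe u

/-- A sequence of natural numbers dominating its partial sums dominates every finite sum of
distinct earlier terms. -/
theorem cardinal_sum_lt_of_dominating {n : ℕ → ℕ} {k : ℕ}
    (hk : (∑ j ∈ Finset.range k, n j) < n k) {ι : Type u} (c : ι → Cardinal.{u})
    (hc : Function.Injective c) (hlt : ∀ i, ∃ j < k, c i = n j) :
    Cardinal.sum c < n k := by
  classical
  choose j hjk hj using hlt
  have hjinj : Function.Injective j := fun a b hab => hc (by rw [hj a, hj b, hab])
  have : Finite ι := Finite.of_injective (fun i => (⟨j i, hjk i⟩ : Fin k))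
    fun a b hab => hjinj (by simpa using hab)
  have := Fintype.ofFinite ι
  have hsum : Cardinal.sum c = ((∑ i, n (j i) : ℕ) : Cardinal.{u}) := by
    have h : Cardinal.sum c = #(Σ i, ULift.{u} (Fin (n (j i)))) := by
      rw [Cardinal.mk_sigma]
      exact congrArg Cardinal.sum (funext fun i => by simp [hj])
    rw [h, Cardinal.mk_fintype, Fintype.card_sigma]
    simp
  rw [hsum, Nat.cast_lt]
  refine lt_of_le_of_lt ?_ hk
  rw [← Finset.sum_image (f := n) (s := Finset.univ) (g := j) (fun a _ b _ h => hjinj h)]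
  refine Finset.sum_le_sum_of_subset fun x hx => ?_
  obtain ⟨i, -, rfl⟩ := Finset.mem_image.1 hx
  exact Finset.mem_range.2 (hjk i)

/-- An infinite cardinal `μ` bounds the size of any family of distinct cardinals `≤ μ`. -/
theorem mk_le_of_injective_cardinal {μ : Cardinal.{u}} (hμ : ℵ₀ ≤ μ) {ι : Type u}
    (c : ι → Cardinal.{u}) (hc : Function.Injective c) (hle : ∀ i, c i ≤ μ) : #ι ≤ μ := by
  have hinj : Function.Injective
      (fun i => (⟨(c i).ord, Order.lt_succ_of_le (Cardinal.ord_le_ord.2 (hle i))⟩ :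
        Set.Iio (Order.succ μ.ord))) :=
    fun a b hab => hc (Cardinal.ord_injective (congrArg Subtype.val hab))
  have h := Cardinal.mk_le_of_injective (f := fun i : ULift.{u + 1} ι =>
    (⟨(c i.down).ord, Order.lt_succ_of_le (Cardinal.ord_le_ord.2 (hle i.down))⟩ :
        Set.Iio (Order.succ μ.ord))) (hinj.comp ULift.down_injective)
  rw [Cardinal.mk_Iio_ordinal, Cardinal.mk_uLift, Cardinal.lift_le] at h
  simpa [Order.succ_eq_add_one, Cardinal.add_one_eq hμ] using h

/-- If a sum of distinct elements of `R` belongs to `R`, then it is one of the summands. -/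
theorem exists_eq_sum_of_mem_setR {κ : Cardinal.{u}} {n : ℕ → ℕ}
    (hn : ∀ i, (∑ j ∈ Finset.range i, n j) < n i) {ι : Type u} (c : ι → Cardinal.{u})
    (hc : Function.Injective c) (hcR : ∀ i, c i ∈ setR κ n)
    (hsum : Cardinal.sum c ∈ setR κ n) : ∃ i, c i = Cardinal.sum c := by
  by_contra! hne
  have hlt : ∀ i, c i < Cardinal.sum c := fun i => lt_of_le_of_ne (Cardinal.le_sum c i) (hne i)
  rcases hsum with ⟨k, hk⟩ | ⟨hinf, -, μ, hμ⟩
  · have hk : (n k : Cardinal.{u}) = Cardinal.sum c := hk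
    refine absurd hk.symm (cardinal_sum_lt_of_dominating (hn k) c hc fun i => ?_).ne
    have hik : c i < n k := hk ▸ hlt i
    rcases hcR i with ⟨j, hj⟩ | ⟨hi, -⟩
    · have hj : (n j : Cardinal.{u}) = c i := hj
      refine ⟨j, ?_, hj.symm⟩
      by_contra! hkj
      rw [← hj, Nat.cast_lt] at hik
      rcases hkj.eq_or_lt with rfl | hkj
      · exact lt_irrefl _ hik
      · have := Finset.single_le_sum (f := n) (fun _ _ => Nat.zero_le _) (Finset.mem_range.2 hkj)
        have := hn j
        omega
    · exact absurd (hi.trans_lt hik) (Cardinal.natCast_lt_aleph0).not_gt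
  · have hμ0 : ℵ₀ ≤ μ := by
      by_contra! h
      exact absurd (Cardinal.isSuccLimit_aleph0.succ_lt h) (by rw [← hμ]; exact hinf.not_gt)
    have hle : ∀ i, c i ≤ μ := fun i => Order.lt_succ_iff.1 (hμ ▸ hlt i)
    have : Cardinal.sum c ≤ μ := calc
      Cardinal.sum c ≤ Cardinal.sum fun _ : ι => μ := Cardinal.sum_le_sum _ _ hle
      _ = #ι * μ := Cardinal.sum_const' _ _
      _ ≤ μ * μ := mul_le_mul_left (mk_le_of_injective_cardinal hμ0 c hc hle) μ
      _ = μ := Cardinal.mul_eq_self hμ0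
    exact absurd (Order.lt_succ μ) (by rw [← hμ]; exact this.not_gt)

section Kernel

variable {X : Type u} {B : Set Cardinal.{u}} {g : X → X}

theorem kernelSeq_mk_fiber_ne_zero (g : X → X) (x : X) :
    kernelSeq g #(g ⁻¹' {g x}) ≠ 0 :=
  Cardinal.mk_ne_zero_iff.2 ⟨⟨g ⁻¹' {g x}, ⟨g x, rfl⟩, ⟨x, rfl⟩, rfl⟩⟩

theorem mk_fiber_mem (h0 : ∀ ξ, ξ ∉ B → kernelSeq g ξ = 0) (x : X) : #(g ⁻¹' {g x}) ∈ B :=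
  not_imp_comm.1 (h0 _) (kernelSeq_mk_fiber_ne_zero g x)

theorem eq_of_mk_fiber_eq (h1 : ∀ ξ ∈ B, kernelSeq g ξ = 1)
    (h0 : ∀ ξ, ξ ∉ B → kernelSeq g ξ = 0) {x y : X}
    (hxy : #(g ⁻¹' {g x}) = #(g ⁻¹' {g y})) : g x = g y := by
  have hs := (Cardinal.le_one_iff_subsingleton.1 (h1 _ (mk_fiber_mem h0 y)).le).elim
    ⟨g ⁻¹' {g x}, ⟨g x, rfl⟩, ⟨x, rfl⟩, hxy⟩ ⟨g ⁻¹' {g y}, ⟨g y, rfl⟩, ⟨y, rfl⟩, rfl⟩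
  have hs : g ⁻¹' {g x} = g ⁻¹' {g y} := congrArg Subtype.val hs
  have hx : x ∈ g ⁻¹' {g x} := rfl
  rw [hs] at hx
  exact hx

theorem exists_fiber_of_kernelSeq_eq_one {ξ : Cardinal.{u}} (h : kernelSeq g ξ = 1) :
    ∃ y, #(g ⁻¹' {y}) = ξ := by
  obtain ⟨⟨_, ⟨y, rfl⟩, -, hy⟩⟩ := Cardinal.mk_ne_zero_iff.1 (h.trans_ne one_ne_zero)
  exact ⟨y, hy⟩

theorem not_bijective_of_kernelSeq [Infinite X] (h1 : ∀ ξ ∈ B, kernelSeq g ξ = 1)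
    (h0 : ∀ ξ, ξ ∉ B → kernelSeq g ξ = 0) : ¬ Function.Bijective g := by
  intro hg
  obtain ⟨x, y, hxy⟩ := exists_pair_ne X
  have h (z : X) : #(g ⁻¹' {g z}) = 1 := by
    have : g ⁻¹' {g z} = {z} := by ext w; simp [hg.1.eq_iff]
    rw [this, Cardinal.mk_singleton]
  exact hxy (hg.1 (eq_of_mk_fiber_eq h1 h0 ((h x).trans (h y).symm)))

/-- If the fibers of `g` have distinct cardinalities, all of them in `B ⊆ R`, then the
cardinality of a union of fibers can lie in `R` only if it lies in `B`. -/
theorem mk_preimage_mem_of_mem_setR {κ : Cardinal.{u}} {n : ℕ → ℕ}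
    (hn : ∀ i, (∑ j ∈ Finset.range i, n j) < n i) (hB : B ⊆ setR κ n)
    (h1 : ∀ ξ ∈ B, kernelSeq g ξ = 1) (h0 : ∀ ξ, ξ ∉ B → kernelSeq g ξ = 0)
    (T : Set X) (hT : #(g ⁻¹' T) ∈ setR κ n) : #(g ⁻¹' T) ∈ B := by
  let c : ↥(T ∩ Set.range g) → Cardinal.{u} := fun y => #(g ⁻¹' {(y : X)})
  have hcB : ∀ y, c y ∈ B := by
    rintro ⟨_, -, x, rfl⟩
    exact mk_fiber_mem h0 x
  have hc : Function.Injective c := by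
    rintro ⟨_, _, x, rfl⟩ ⟨_, _, y, rfl⟩ hxy
    exact Subtype.ext (eq_of_mk_fiber_eq h1 h0 hxy)
  have hsum : #(g ⁻¹' T) = Cardinal.sum c := by
    rw [← Cardinal.mk_iUnion_eq_sum_mk fun a b hab => ?_]
    · congr 2
      ext x
      simp
    · exact Disjoint.preimage g (by simpa [Subtype.ext_iff] using hab)
  rw [hsum] at hT ⊢
  obtain ⟨i, hi⟩ := exists_eq_sum_of_mem_setR hn c hc (fun i => hB (hcB i)) hT
  exact hi ▸ hcB i

end Kernel

/-- A member of the monoid generated by the permutations and `F` either is a permutation or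
is of the form `h ∘ g ∘ p` with `g ∈ F` and `p` a permutation. -/
theorem bijective_or_exists_of_mem_closure {X : Type u} {F : Set (Function.End X)}
    {f : Function.End X}
    (hf : f ∈ Submonoid.closure ((permSubmonoid X : Set (Function.End X)) ∪ F)) :
    Function.Bijective f ∨
      ∃ g ∈ F, ∃ h p : Function.End X, Function.Bijective p ∧ f = h * (g * p) := by
  induction hf using Submonoid.closure_induction with
  | mem f hf =>
    rcases hf with hf | hf
    · exact Or.inl hf
    · exact Or.inr ⟨f, hf, 1, 1, Function.bijective_id, by simp⟩
  | one => exact Or.inl Function.bijective_id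
  | mul a b _ _ ha hb =>
    rcases hb with hb | ⟨g, hg, h, p, hp, rfl⟩
    · rcases ha with ha | ⟨g, hg, h, p, hp, rfl⟩
      · exact Or.inl (ha.comp hb)
      · exact Or.inr ⟨g, hg, h, p * b, hp.comp hb, by simp only [mul_assoc]⟩
    · exact Or.inr ⟨g, hg, a * h, p, hp, by simp only [mul_assoc]⟩

/-- If `A, A_1, …, A_n ⊆ R` are unbounded with `A ⊄ A_i` for all `i`, then `f_A` is not in
the submonoid generated by the permutations together with `f_{A_1}, …, f_{A_n}`. -/
theorem fA_not_mem_closure {X : Type u} [Infinite X] (n : ℕ → ℕ)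
    (hn : ∀ i, (∑ j ∈ Finset.range i, n j) < n i)
    (m : ℕ) (A : Set Cardinal.{u}) (As : Fin m → Set Cardinal.{u})
    (hAR : A ⊆ setR #X n) (hAsR : ∀ i, As i ⊆ setR #X n)
    (hAub : setSum A = Cardinal.lift.{u + 1} #X)
    (hAsub : ∀ i, setSum (As i) = Cardinal.lift.{u + 1} #X)
    (hnsub : ∀ i, ¬ A ⊆ As i)
    (fA : Function.End X) (fAs : Fin m → Function.End X)
    (hfA1 : ∀ ξ ∈ A, kernelSeq fA ξ = 1)
    (hfA0 : ∀ ξ : Cardinal.{u}, ξ ∉ A → kernelSeq fA ξ = 0)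
    (hfAs1 : ∀ i, ∀ ξ ∈ As i, kernelSeq (fAs i) ξ = 1)
    (hfAs0 : ∀ i, ∀ ξ : Cardinal.{u}, ξ ∉ As i → kernelSeq (fAs i) ξ = 0) :
    fA ∉ Submonoid.closure
      ((permSubmonoid X : Set (Function.End X)) ∪ Set.range fAs) := by
  intro hmem
  rcases bijective_or_exists_of_mem_closure hmem with hbij | ⟨_, ⟨i, rfl⟩, h, p, hp, hf⟩
  · exact not_bijective_of_kernelSeq hfA1 hfA0 hbij
  · refine hnsub i fun ξ hξ => ?_
    obtain ⟨z, hz⟩ := exists_fiber_of_kernelSeq_eq_one (hfA1 ξ hξ)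
    have hcard : #(fAs i ⁻¹' (h ⁻¹' {z})) = ξ := by
      rw [← hz, hf]
      exact (Cardinal.mk_preimage_equiv (Equiv.ofBijective p hp) _).symm
    rw [← hcard]
    exact mk_preimage_mem_of_mem_setR hn (hAsR i) (hfAs1 i) (hfAs0 i) _
      (hcard ▸ hAR hξ)
end

section
/- Let κ = ℵ_α be an infinite cardinal and λ = max(|α|, ℵ₀), and let R = {n_i : i ∈ ω} ∪ {ξ : ξ an infinite successor cardinal, ξ ≤ κ} for a sequence (n_i) of natural numbers with Σ_{j<i} n_j < n_i. Then there exists an independent family I of unbounded subsets of R with |I| = 2^λ, i.e., a family of size 2^λ of subsets A ⊆ R with Σ_{ξ∈A} ξ = κ such that for all finite nonempty disjoint B₁, B₂ ⊆ I the set ⋂_{A∈B₁} A ∩ ⋂_{A∈B₂} (R \ A) is nonempty. -/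
open Cardinal

universe u

/-- Hausdorff's theorem: on every infinite type `T` there is an independent family of subsets
indexed by `Set T`. -/
theorem exists_independent_indexed (T : Type*) [Infinite T] :
    ∃ A : Set T → Set T, ∀ B₁ B₂ : Finset (Set T), Disjoint B₁ B₂ →
      ∃ x, (∀ S ∈ B₁, x ∈ A S) ∧ ∀ S ∈ B₂, x ∉ A S := by
  classical
  have hcard : #(Finset T × Finset (Finset T)) = #T := by
    rw [Cardinal.mk_prod, Cardinal.mk_finset_of_infinite, Cardinal.mk_finset_of_infinite,
      Cardinal.mk_finset_of_infinite, Cardinal.lift_id]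
    exact Cardinal.mul_eq_self (Cardinal.aleph0_le_mk T)
  obtain ⟨e⟩ := Cardinal.eq.1 hcard
  refine ⟨fun S => e '' {p | p.1.filter (· ∈ S) ∈ p.2}, fun B₁ B₂ hB => ?_⟩
  have hsep : ∀ S S' : Set T, ∃ F : Finset T, S ≠ S' → ∃ t ∈ F, ¬ (t ∈ S ↔ t ∈ S') := by
    intro S S'
    by_cases h : S = S'
    · exact ⟨∅, fun h' => absurd h h'⟩
    · obtain ⟨t, ht⟩ := not_forall.1 fun H => h (Set.ext H)
      exact ⟨{t}, fun _ => ⟨t, Finset.mem_singleton_self t, ht⟩⟩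
  choose f hf using hsep
  let F : Finset T := B₁.biUnion fun S => B₂.biUnion fun S' => f S S'
  refine ⟨e (F, B₁.image fun S => F.filter (· ∈ S)), fun S hS => ?_, fun S' hS' => ?_⟩
  · exact Set.mem_image_of_mem e (Finset.mem_image_of_mem (fun S : Set T => F.filter (· ∈ S)) hS)
  · rw [e.injective.mem_set_image]
    intro h
    obtain ⟨S, hS, hSS'⟩ := Finset.mem_image.1 h
    have hne : S ≠ S' := by
      rintro rfl
      exact Finset.disjoint_left.1 hB hS hS'
    obtain ⟨t, ht, hts⟩ := hf S S' hne
    have htF : t ∈ F := Finset.mem_biUnion.2 ⟨S, hS, Finset.mem_biUnion.2 ⟨S', hS', ht⟩⟩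
    have := Finset.ext_iff.1 hSS' t
    simp only [Finset.mem_filter, htF, true_and] at this
    exact hts this

/-- If of each set and its complement at least one satisfies `P`, then there is an independent
family indexed by `Set T` all of whose members satisfy `P`. -/
theorem exists_independent_indexed_forall {T : Type*} [Infinite T] {P : Set T → Prop}
    (hP : ∀ A, P A ∨ P Aᶜ) :
    ∃ A : Set T → Set T, (∀ S, P (A S)) ∧ ∀ B₁ B₂ : Finset (Set T), Disjoint B₁ B₂ →
      ∃ x, (∀ S ∈ B₁, x ∈ A S) ∧ ∀ S ∈ B₂, x ∉ A S := by
  classical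
  obtain ⟨A, hA⟩ := exists_independent_indexed T
  refine ⟨fun S => if P (A S) then A S else (A S)ᶜ, fun S => ?_, fun B₁ B₂ hB => ?_⟩
  · dsimp only
    split_ifs with h
    · exact h
    · exact (hP _).resolve_left h
  · obtain ⟨x, h₁, h₂⟩ := hA
      (B₁.filter (fun S => P (A S)) ∪ B₂.filter fun S => ¬ P (A S))
      (B₂.filter (fun S => P (A S)) ∪ B₁.filter fun S => ¬ P (A S)) (by
        rw [Finset.disjoint_left] at hB ⊢
        intro S
        simp only [Finset.mem_union, Finset.mem_filter]
        have := @hB S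
        tauto)
    simp only [Finset.mem_union, Finset.mem_filter] at h₁ h₂
    refine ⟨x, fun S hS => ?_, fun S hS => ?_⟩
    · dsimp only
      split_ifs with h
      · exact h₁ S (Or.inl ⟨hS, h⟩)
      · exact h₂ S (Or.inr ⟨hS, h⟩)
    · dsimp only
      split_ifs with h
      · exact h₂ S (Or.inl ⟨hS, h⟩)
      · exact not_not.2 (h₁ S (Or.inr ⟨hS, h⟩))

theorem setSum_eq_mk (A : Set Cardinal.{u}) : setSum A = #(Σ η : A, (η : Cardinal.{u}).out) :=
  rfl

theorem setSum_mono {A B : Set Cardinal.{u}} (h : A ⊆ B) : setSum A ≤ setSum B := by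
  rw [setSum_eq_mk, setSum_eq_mk]
  refine Cardinal.mk_le_of_injective
    (f := fun p => ⟨⟨p.1.1, h p.1.2⟩, p.2⟩) ?_
  rintro ⟨⟨a, ha⟩, x⟩ ⟨⟨b, hb⟩, y⟩ hxy
  simp only [Sigma.mk.injEq, Subtype.mk.injEq] at hxy
  obtain ⟨rfl, hxy⟩ := hxy
  simpa using hxy

theorem setSum_union_le (A B : Set Cardinal.{u}) : setSum (A ∪ B) ≤ setSum A + setSum B := by
  rw [setSum_eq_mk, setSum_eq_mk, setSum_eq_mk, Cardinal.add_def]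
  refine Cardinal.mk_le_of_surjective
    (f := Sum.elim (fun p => ⟨⟨p.1.1, Or.inl p.1.2⟩, p.2⟩)
      (fun p => ⟨⟨p.1.1, Or.inr p.1.2⟩, p.2⟩)) ?_
  rintro ⟨⟨a, ha | ha⟩, x⟩
  · exact ⟨Sum.inl ⟨⟨a, ha⟩, x⟩, rfl⟩
  · exact ⟨Sum.inr ⟨⟨a, ha⟩, x⟩, rfl⟩

theorem lift_le_setSum {A : Set Cardinal.{u}} {ξ : Cardinal.{u}} (h : ξ ∈ A) :
    Cardinal.lift.{u + 1} ξ ≤ setSum A := by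
  rw [setSum_eq_mk]
  conv_lhs => rw [← Cardinal.mk_out ξ, ← Cardinal.mk_uLift]
  refine Cardinal.mk_le_of_injective (f := fun x => ⟨⟨ξ, h⟩, x.down⟩) ?_
  intro x y hxy
  exact ULift.down_injective (by simpa using hxy)

theorem mk_le_setSum {A : Set Cardinal.{u}} (h : 0 ∉ A) : #A ≤ setSum A := by
  rw [setSum_eq_mk]
  have hne : ∀ η : A, Nonempty (η : Cardinal.{u}).out := by
    rintro ⟨η, hη⟩
    rw [← Cardinal.mk_ne_zero_iff, Cardinal.mk_out]
    rintro rfl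
    exact h hη
  exact Cardinal.mk_le_of_surjective (f := Sigma.fst)
    fun η => ⟨⟨η, (hne η).some⟩, rfl⟩

theorem setSum_le_mk_mul {A : Set Cardinal.{u}} {κ : Cardinal.{u}} (h : ∀ ξ ∈ A, ξ ≤ κ) :
    setSum A ≤ #A * Cardinal.lift.{u + 1} κ := by
  have := Cardinal.sum_le_sum (fun η : A => (η : Cardinal.{u})) (fun _ => κ) fun η => h η η.2
  rw [Cardinal.sum_const, Cardinal.lift_id'.{u, u + 1}] at this
  exact this

/-- The infinite successor cardinals up to `ℵ_ α` are indexed by the ordinals below `α`. -/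
theorem setOf_succ_le_aleph (α : Ordinal.{u}) :
    {ξ : Cardinal.{u} | ℵ₀ ≤ ξ ∧ ξ ≤ Cardinal.aleph α ∧ ∃ μ : Cardinal.{u}, ξ = Order.succ μ} =
      (fun β => Order.succ (Cardinal.aleph β)) '' Set.Iio α := by
  ext ξ
  constructor
  · rintro ⟨h₁, h₂, μ, rfl⟩
    have hμ : ℵ₀ ≤ μ := by
      by_contra! h
      exact absurd (Cardinal.isSuccLimit_aleph0.succ_lt h) h₁.not_gt
    obtain ⟨β, rfl⟩ := Cardinal.mem_range_aleph_iff.2 hμ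
    exact ⟨β, Cardinal.aleph_lt_aleph.1 (Order.succ_le_iff.1 h₂), rfl⟩
  · rintro ⟨β, hβ, rfl⟩
    exact ⟨(Cardinal.aleph0_le_aleph β).trans (Order.le_succ _),
      Order.succ_le_of_lt (Cardinal.aleph_lt_aleph.2 hβ), _, rfl⟩

theorem strictMono_of_sum_range_lt {n : ℕ → ℕ} (hn : ∀ i, (∑ j ∈ Finset.range i, n j) < n i) :
    StrictMono n :=
  fun _ _ h => (Finset.single_le_sum (fun _ _ => Nat.zero_le _)
    (Finset.mem_range.2 h)).trans_lt (hn _)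

theorem mk_setR (α : Ordinal.{u}) {n : ℕ → ℕ} (hn : n.Injective) :
    #(setR (Cardinal.aleph α) n) = Cardinal.lift.{u + 1} (max α.card ℵ₀) := by
  have h₁ : #(Set.range fun i : ℕ => (n i : Cardinal.{u})) = ℵ₀ := by
    have := Cardinal.mk_range_eq_of_injective (f := fun i : ℕ => (n i : Cardinal.{u}))
      (Nat.cast_injective.comp hn)
    simpa only [Cardinal.mk_nat, Cardinal.lift_aleph0, Cardinal.lift_uzero,
      Cardinal.lift_id] using this
  have h₂ : #((fun β => Order.succ (Cardinal.aleph β)) '' Set.Iio α) =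
      Cardinal.lift.{u + 1} α.card := by
    have hinj : Function.Injective fun β : Ordinal.{u} => Order.succ (Cardinal.aleph β) :=
      Order.succ_injective.comp Cardinal.aleph.injective
    rw [Cardinal.mk_image_eq hinj, Cardinal.mk_Iio_ordinal]
  rw [setR, setOf_succ_le_aleph, Cardinal.lift_max, Cardinal.lift_aleph0]
  apply le_antisymm
  · refine (Cardinal.mk_union_le _ _).trans ?_
    rw [h₁, h₂, Cardinal.add_eq_max le_rfl, max_comm]
  · refine max_le ?_ ?_
    · rw [← h₂]
      exact Cardinal.mk_le_mk_of_subset Set.subset_union_right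
    · rw [← h₁]
      exact Cardinal.mk_le_mk_of_subset Set.subset_union_left

theorem setSum_setR_le (α : Ordinal.{u}) {n : ℕ → ℕ} (hn : n.Injective) :
    setSum (setR (Cardinal.aleph α) n) ≤ Cardinal.lift.{u + 1} (Cardinal.aleph α) := by
  refine (setSum_le_mk_mul (κ := Cardinal.aleph α) ?_).trans ?_
  · rintro _ (⟨_, rfl⟩ | h)
    · exact Cardinal.natCast_le_aleph0.trans (Cardinal.aleph0_le_aleph α)
    · exact h.2.1
  · rw [mk_setR α hn, ← Cardinal.lift_mul, Cardinal.lift_le]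
    exact Cardinal.mul_le_of_le (Cardinal.aleph0_le_aleph α)
      (max_le (Ordinal.card_le_aleph α) (Cardinal.aleph0_le_aleph α)) le_rfl

theorem setSum_setR (α : Ordinal.{u}) {n : ℕ → ℕ} (hn : n.Injective) (hpos : ∀ i, n i ≠ 0) :
    setSum (setR (Cardinal.aleph α) n) = Cardinal.lift.{u + 1} (Cardinal.aleph α) := by
  refine (setSum_setR_le α hn).antisymm ?_
  by_contra! hlt
  obtain ⟨c, hc⟩ := Cardinal.mem_range_lift_of_le hlt.le
  have h0 : (0 : Cardinal.{u}) ∉ setR (Cardinal.aleph α) n := by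
    rintro (⟨i, hi⟩ | h)
    · exact hpos i (Nat.cast_eq_zero.1 hi)
    · exact Cardinal.aleph0_ne_zero (nonpos_iff_eq_zero.1 h.1)
  have hinf : ℵ₀ ≤ c := by
    rw [← Cardinal.aleph0_le_lift.{u, u + 1}, hc]
    refine le_trans ?_ (mk_le_setSum h0)
    rw [mk_setR α hn, Cardinal.aleph0_le_lift]
    exact le_max_right _ _
  rw [← hc, Cardinal.lift_lt] at hlt
  have hmem : Order.succ c ∈ setR (Cardinal.aleph α) n :=
    Or.inr ⟨hinf.trans (Order.le_succ c), Order.succ_le_of_lt hlt, c, rfl⟩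
  have := lift_le_setSum hmem
  rw [← hc, Cardinal.lift_le] at this
  exact (Order.lt_succ c).not_ge this

/-- There is an independent family of unbounded subsets of `R` of cardinality `2^λ`. -/
theorem exists_independent_family_of_unbounded {α : Ordinal.{u}} (κ lam : Cardinal.{u})
    (hκ : κ = Cardinal.aleph α) (hlam : lam = max α.card ℵ₀)
    (n : ℕ → ℕ) (hn : ∀ i, (∑ j ∈ Finset.range i, n j) < n i) :
    ∃ I : Set (Set Cardinal.{u}),
      #I = Cardinal.lift.{u + 1} ((2 : Cardinal.{u}) ^ lam) ∧
      (∀ A ∈ I, A ⊆ setR κ n ∧ setSum A = Cardinal.lift.{u + 1} κ) ∧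
      (∀ B₁ B₂ : Finset (Set Cardinal.{u}), ↑B₁ ⊆ I → ↑B₂ ⊆ I →
        B₁.Nonempty → B₂.Nonempty → Disjoint B₁ B₂ →
        ((⋂ A ∈ B₁, A) ∩ ⋂ A ∈ B₂, (setR κ n \ A)).Nonempty) := by
  subst hκ hlam
  have hmono := strictMono_of_sum_range_lt hn
  set R := setR (Cardinal.aleph α) n with hR
  have hmkR : #R = Cardinal.lift.{u + 1} (max α.card ℵ₀) := mk_setR α hmono.injective
  have hsumR : setSum R = Cardinal.lift.{u + 1} (Cardinal.aleph α) :=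
    setSum_setR α hmono.injective fun i => ((Nat.zero_le _).trans_lt (hn i)).ne'
  have hinf : Infinite R := by
    rw [Cardinal.infinite_iff, hmkR, Cardinal.aleph0_le_lift]
    exact le_max_right _ _
  have hsub : ∀ A : Set R, Subtype.val '' A ⊆ R := fun A => Subtype.coe_image_subset R A
  have hflip : ∀ A : Set R,
      setSum (Subtype.val '' A) = Cardinal.lift.{u + 1} (Cardinal.aleph α) ∨
      setSum (Subtype.val '' Aᶜ) = Cardinal.lift.{u + 1} (Cardinal.aleph α) := by
    intro A
    have hU : (Subtype.val '' A ∪ Subtype.val '' Aᶜ : Set Cardinal.{u}) = R := by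
      rw [← Set.image_union, Set.union_compl_self, Set.image_univ, Subtype.range_coe]
    have hle := fun A : Set R => (setSum_mono (hsub A)).trans_eq hsumR
    by_contra! h
    have hlt := Cardinal.add_lt_of_lt
      (by rw [Cardinal.aleph0_le_lift]; exact Cardinal.aleph0_le_aleph α)
      ((hle A).lt_of_ne h.1) ((hle Aᶜ).lt_of_ne h.2)
    have := setSum_union_le (Subtype.val '' A) (Subtype.val '' Aᶜ)
    rw [hU, hsumR] at this
    exact hlt.not_ge this
  obtain ⟨A, hA, hind⟩ := exists_independent_indexed_forall hflip
  have hinj : Function.Injective fun S => (Subtype.val '' A S : Set Cardinal.{u}) := by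
    intro S S' h
    by_contra hne
    obtain ⟨x, h₁, h₂⟩ := hind {S} {S'} (Finset.disjoint_singleton.2 hne)
    have hAA : A S = A S' := Subtype.val_injective.image_injective h
    exact h₂ S' (Finset.mem_singleton_self _) (hAA ▸ h₁ S (Finset.mem_singleton_self _))
  refine ⟨Set.range fun S => (Subtype.val '' A S : Set Cardinal.{u}), ?_, ?_, ?_⟩
  · rw [Cardinal.mk_range_eq _ hinj, Cardinal.mk_set, hmkR, Cardinal.lift_power,
      Cardinal.lift_two]
  · rintro _ ⟨S, rfl⟩
    exact ⟨hsub _, hA S⟩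
  · intro B₁ B₂ hB₁ hB₂ _ _ hdisj
    obtain ⟨x, h₁, h₂⟩ := hind (B₁.preimage _ hinj.injOn) (B₂.preimage _ hinj.injOn) (by
      rw [Finset.disjoint_left] at hdisj ⊢
      intro S hS hS'
      rw [Finset.mem_preimage] at hS hS'
      exact hdisj hS hS')
    refine ⟨x, Set.mem_iInter₂.2 fun C hC => ?_, Set.mem_iInter₂.2 fun C hC => ?_⟩
    · obtain ⟨S, rfl⟩ := hB₁ hC
      exact Set.mem_image_of_mem _ (h₁ S (Finset.mem_preimage.2 hC))
    · obtain ⟨S, rfl⟩ := hB₂ hC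
      refine ⟨x.2, fun hx => h₂ S (Finset.mem_preimage.2 hC) ?_⟩
      exact (Subtype.val_injective.mem_set_image).1 hx
end
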